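/- The sequence α_d is nonincreasing: α_{d+1} ≤ α_d for all d ≥ 1, where α_d is the infimum of α such that some nearest neighbor Z^d SFT X with alphabet A has more than one measure of maximal entropy and h(X) ≥ log|A| - α. -/

import Mathlib

open MeasureTheory

abbrev Site (d : ℕ) := Fin d → ℤ

def unitVec (d : ℕ) (i : Fin d) : Site d := fun j => if j = i then 1 else 0

def adjSites {d : ℕ} (u v : Site d) : Prop :=
  ∃ i : Fin d, v = u + unitVec d i ∨ u = v + unitVec d i

def innerBd {d : ℕ} (S : Set (Site d)) : Set (Site d) :=
  {v | v ∈ S ∧ ∃ u, u ∉ S ∧ adjSites v u}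

def outerBd {d : ℕ} (S : Set (Site d)) : Set (Site d) :=
  {v | v ∉ S ∧ ∃ u, u ∈ S ∧ adjSites v u}

def cube (d n : ℕ) : Set (Site d) := {v | ∀ i, 1 ≤ v i ∧ v i ≤ (n : ℤ)}

def symBox (d n : ℕ) : Set (Site d) := {v | ∀ i, |v i| ≤ (n : ℤ)}

def symBoxR (d : ℕ) (r : ℝ) : Set (Site d) := {v | ∀ i, |((v i : ℤ) : ℝ)| ≤ r}

/-- A nearest neighbor `ℤ^d` SFT is specified by its allowed adjacent pairs
in each of the `d` cardinal directions: `adj i a b` means the pair `a b` may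
appear at sites `v, v + e i`. -/
structure NNSFT (d : ℕ) (A : Type) where
  adj : Fin d → A → A → Prop

namespace NNSFT

variable {d : ℕ} {A : Type}

/-- The points of the subshift. -/
def pts (X : NNSFT d A) : Set (Site d → A) :=
  {x | ∀ (i : Fin d) (v : Site d), X.adj i (x v) (x (v + unitVec d i))}

/-- A configuration on shape `S` is locally admissible if it contains no
forbidden adjacent pair inside `S`. -/
def locAdm (X : NNSFT d A) (S : Set (Site d)) (w : Site d → A) : Prop :=
  ∀ (i : Fin d) (v : Site d), v ∈ S → v + unitVec d i ∈ S →
    X.adj i (w v) (w (v + unitVec d i))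

/-- A configuration on shape `S` is globally admissible if it extends to a
point of the subshift. -/
def globAdm (X : NNSFT d A) (S : Set (Site d)) (w : Site d → A) : Prop :=
  ∃ x ∈ X.pts, ∀ v ∈ S, x v = w v

/-- `X` is `ε`-full with good-letter set `G`. -/
def epsFullWith [Fintype A] (X : NNSFT d A) (ε : ℝ) (G : Set A) : Prop :=
  ((G.ncard : ℝ) > (1 - ε) * Fintype.card A) ∧
  ∀ g ∈ G, ∀ i : Fin d,
    (({a : A | X.adj i g a}.ncard : ℝ) > (1 - ε) * Fintype.card A) ∧
    (({a : A | X.adj i a g}.ncard : ℝ) > (1 - ε) * Fintype.card A)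

/-- `X` is `ε`-full. -/
def epsFull [Fintype A] (X : NNSFT d A) (ε : ℝ) : Prop :=
  ∃ G : Set A, X.epsFullWith ε G

/-- The globally admissible patterns on shape `S`. -/
def langSet (X : NNSFT d A) (S : Set (Site d)) : Set (S → A) :=
  (fun x => S.restrict x) '' X.pts

/-- The number of globally admissible patterns on shape `S`. -/
noncomputable def langCard (X : NNSFT d A) (S : Set (Site d)) : ℕ :=
  (X.langSet S).ncard

/-- Topological entropy, as the infimum (= limit, by subadditivity) of the
normalized log-counts of globally admissible patterns on cubes. -/
noncomputable def entropy (X : NNSFT d A) : ℝ :=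
  ⨅ n : ℕ+, Real.log (X.langCard (cube d (n : ℕ))) / ((n : ℕ) : ℝ) ^ d

end NNSFT

instance confMS (d : ℕ) (A : Type) : MeasurableSpace (Site d → A) :=
  @MeasurableSpace.pi (Site d) (fun _ => A) (fun _ => ⊤)

def shiftMap {d : ℕ} {A : Type} (t : Site d) (x : Site d → A) : Site d → A :=
  fun v => x (v + t)

/-- Shift invariance of a measure on the full shift. -/
def shiftInv {d : ℕ} {A : Type} (μ : Measure (Site d → A)) : Prop :=
  ∀ t : Site d, Measure.map (shiftMap t) μ = μ

/-- The cylinder set of configurations agreeing with `w` on `S`. -/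
def cylEvent {d : ℕ} {A : Type} (S : Set (Site d)) (w : Site d → A) :
    Set (Site d → A) := {x | ∀ v ∈ S, x v = w v}

/-- Shannon entropy of the marginal of `μ` on the cube `[1,n]^d`. -/
noncomputable def blockEnt {d : ℕ} {A : Type} [Fintype A]
    (μ : Measure (Site d → A)) (n : ℕ) : ℝ :=
  ∑ w : (Fin d → Fin n) → A,
    Real.negMulLog
      ((μ {x | ∀ p : Fin d → Fin n, x (fun i => (p i : ℤ) + 1) = w p}).toReal)

/-- Measure-theoretic entropy, as the infimum (= limit, by subadditivity) of
normalized Shannon entropies of cube marginals. -/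
noncomputable def measEnt {d : ℕ} {A : Type} [Fintype A]
    (μ : Measure (Site d → A)) : ℝ :=
  ⨅ n : ℕ+, blockEnt μ (n : ℕ) / ((n : ℕ) : ℝ) ^ d

/-- `μ` is a measure of maximal entropy for `X`. -/
def NNSFT.isMME {d : ℕ} {A : Type} [Fintype A] (X : NNSFT d A)
    (μ : Measure (Site d → A)) : Prop :=
  IsProbabilityMeasure μ ∧ shiftInv μ ∧ μ X.pts = 1 ∧ measEnt μ = X.entropy

/-- `badConn bad S T x` : in the configuration `x` there is a path of
`bad`-letters from `S` to `T`. -/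
def badConn {d : ℕ} {A : Type} (bad : A → Prop) (S T : Set (Site d))
    (x : Site d → A) : Prop :=
  ∃ (L : ℕ) (p : ℕ → Site d), p 0 ∈ S ∧ p L ∈ T ∧
    (∀ j < L, adjSites (p j) (p (j + 1))) ∧ ∀ j ≤ L, bad (x (p j))

/-- `alphaD d` is the infimum of `α` such that some nearest neighbor `ℤ^d`
SFT with alphabet `A` has more than one measure of maximal entropy and
entropy at least `log |A| - α`. -/
noncomputable def alphaD (d : ℕ) : ℝ :=
  sInf {α : ℝ | ∃ (A : Type) (inst : Fintype A) (X : NNSFT d A)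
      (μ ν : Measure (Site d → A)),
    @NNSFT.isMME d A inst X μ ∧ @NNSFT.isMME d A inst X ν ∧ μ ≠ ν ∧
    X.entropy ≥ Real.log (@Fintype.card A inst) - α}

theorem measurable_evalSite {d : ℕ} {A : Type} (v : Site d) :
    @Measurable (Site d → A) A (confMS d A) ⊤ (fun x => x v) :=
  @measurable_pi_apply (Site d) (fun _ => A) (fun _ => ⊤) v

theorem measurable_of_evalSite {d : ℕ} {A : Type} {Ω : Type*} [MeasurableSpace Ω] {f : Ω → Site d → A}
    (hf : ∀ v, @Measurable Ω A _ ⊤ (fun ω => f ω v)) : Measurable f :=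
  @measurable_pi_lambda Ω (Site d) (fun _ => A) _ (fun _ => ⊤) f hf

theorem measurableSet_evalSite_eq {d : ℕ} {A : Type} (v : Site d) (a : A) :
    MeasurableSet {x : Site d → A | x v = a} :=
  measurable_evalSite v (t := {a}) trivial

theorem measurableSet_forall_eq {d : ℕ} {A ι : Type} [Countable ι] (s : ι → Site d) (w : ι → A) :
    MeasurableSet {x : Site d → A | ∀ p, x (s p) = w p} := by
  rw [Set.ofPred_forall]
  exact MeasurableSet.iInter fun p => measurableSet_evalSite_eq _ _

theorem measurable_shiftMap {d : ℕ} {A : Type} (t : Site d) :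
    Measurable (shiftMap (A := A) t) :=
  measurable_of_evalSite fun v => measurable_evalSite (v + t)

theorem NNSFT.measurableSet_pts {d : ℕ} {A : Type} [Finite A] (X : NNSFT d A) :
    MeasurableSet X.pts := by
  have h : X.pts = ⋂ (i : Fin d) (v : Site d), ⋃ (a : A) (b : A) (_ : X.adj i a b),
      {x | x v = a} ∩ {x | x (v + unitVec d i) = b} := by
    ext x
    simp [NNSFT.pts]
  rw [h]
  exact .iInter fun i => .iInter fun v => .iUnion fun a => .iUnion fun b => .iUnion fun _ =>
    (measurableSet_evalSite_eq _ _).inter (measurableSet_evalSite_eq _ _)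

/-- Stacking a `ℤ`-indexed family of `ℤ^d`-configurations along a new first direction. -/
def stack {d : ℕ} {A : Type} (f : ℤ → Site d → A) : Site (d + 1) → A :=
  fun v => f (v 0) (Fin.tail v)

/-- The SFT with the rules of `X` in the last `d` directions and no restriction in the first. -/
def NNSFT.extend {d : ℕ} {A : Type} (X : NNSFT d A) : NNSFT (d + 1) A where
  adj := Fin.cons (fun _ _ => True) X.adj

/-- The independent product of copies of `μ` along a new first direction. -/
noncomputable def stackMeasure {d : ℕ} {A : Type} (μ : Measure (Site d → A)) :
    Measure (Site (d + 1) → A) :=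
  (Measure.infinitePi fun _ : ℤ => μ).map stack

theorem measurable_stack {d : ℕ} {A : Type} : Measurable (stack (d := d) (A := A)) :=
  measurable_of_evalSite fun v =>
    (measurable_evalSite (Fin.tail v)).comp
      (measurable_pi_apply (X := fun _ : ℤ => Site d → A) (v 0))

theorem tail_unitVec_succ {d : ℕ} (i : Fin d) :
    Fin.tail (unitVec (d + 1) i.succ) = unitVec d i := by
  ext j
  simp [Fin.tail, unitVec]

theorem stack_mem_pts_extend {d : ℕ} {A : Type} (X : NNSFT d A) {f : ℤ → Site d → A} :
    stack f ∈ X.extend.pts ↔ ∀ k, f k ∈ X.pts := by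
  constructor
  · intro h k i v
    have := h i.succ (Fin.cons k v)
    have e : Fin.tail (Fin.cons k v + unitVec (d + 1) i.succ : Site (d + 1))
        = v + unitVec d i := by
      rw [← tail_unitVec_succ i]; rfl
    simpa [NNSFT.extend, stack, e, unitVec, Fin.succ_ne_zero, (Fin.succ_ne_zero _).symm] using this
  · intro h i v
    refine Fin.cases ?_ (fun i => ?_) i
    · simp [NNSFT.extend]
    · have := h (v 0) i (Fin.tail v)
      have e : Fin.tail (v + unitVec (d + 1) i.succ) = Fin.tail v + unitVec d i := by
        rw [← tail_unitVec_succ i]; rfl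
      simpa [NNSFT.extend, stack, e, unitVec, (Fin.succ_ne_zero _).symm] using this

theorem stack_slices {d : ℕ} {A : Type} (x : Site (d + 1) → A) :
    stack (fun k v => x (Fin.cons k v)) = x := by
  funext v
  simp [stack]

theorem cons_mem_cube {d n : ℕ} (k : Fin n) {v : Site d} (hv : v ∈ cube d n) :
    (Fin.cons ((k : ℤ) + 1) v : Site (d + 1)) ∈ cube (d + 1) n := by
  intro i
  refine Fin.cases ?_ (fun i => ?_) i
  · simp only [Fin.cons_zero]; omega
  · simpa using hv i

/-- The pattern on the `k`-th layer of a pattern on a cube. -/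
def layer {d n : ℕ} {A : Type} (w : cube (d + 1) n → A) (k : Fin n) : cube d n → A :=
  fun v => w ⟨Fin.cons ((k : ℤ) + 1) v.1, cons_mem_cube k v.2⟩

theorem layer_injective {d n : ℕ} {A : Type} :
    Function.Injective (layer (d := d) (n := n) (A := A)) := by
  intro w w' h
  funext ⟨v, hv⟩
  have h0 := hv 0
  have hk : (v 0 - 1).toNat < n := by omega
  have := congrFun (congrFun h ⟨(v 0 - 1).toNat, hk⟩) ⟨Fin.tail v, fun i => hv i.succ⟩
  have e : (Fin.cons ((((v 0 - 1).toNat : ℕ) : ℤ) + 1) (Fin.tail v) : Site (d + 1)) = v := by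
    have : (((v 0 - 1).toNat : ℕ) : ℤ) + 1 = v 0 := by omega
    rw [this, Fin.cons_self_tail]
  simpa only [layer, e] using this

theorem image_layer_langSet {d : ℕ} {A : Type} (X : NNSFT d A) {n : ℕ} (hn : 0 < n) :
    layer '' X.extend.langSet (cube (d + 1) n)
      = Set.univ.pi fun _ : Fin n => X.langSet (cube d n) := by
  ext F
  constructor
  · rintro ⟨_, ⟨x, hx, rfl⟩, rfl⟩ k -
    rw [← stack_slices x, stack_mem_pts_extend] at hx
    exact ⟨_, hx (k + 1), rfl⟩
  · intro hF
    choose x hx hxF using fun k => hF k trivial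
    have : Nonempty (Fin n) := ⟨⟨0, hn⟩⟩
    have hinj : Function.Injective fun k : Fin n => (k : ℤ) + 1 := fun a b h => by
      simp only at h; omega
    refine ⟨_, ⟨stack fun z => x (Function.invFun (fun k : Fin n => (k : ℤ) + 1) z),
      (stack_mem_pts_extend X).2 fun k => hx _, rfl⟩, ?_⟩
    funext k v
    have hk : Function.invFun (fun k : Fin n => (k : ℤ) + 1) (k + 1) = k :=
      Function.leftInverse_invFun hinj k
    rw [← hxF]
    change x (Function.invFun (fun k : Fin n => (k : ℤ) + 1) (k + 1)) v.1 = x k v.1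
    rw [hk]

theorem langCard_extend {d : ℕ} {A : Type} (X : NNSFT d A) {n : ℕ} (hn : 0 < n) :
    X.extend.langCard (cube (d + 1) n) = X.langCard (cube d n) ^ n := by
  rw [NNSFT.langCard, ← Set.ncard_image_of_injective _ layer_injective, image_layer_langSet X hn,
    NNSFT.langCard, ← Nat.card_coe_set_eq, Nat.card_congr (Equiv.Set.univPi _), Nat.card_pi]
  simp

theorem entropy_extend {d : ℕ} {A : Type} (X : NNSFT d A) : X.extend.entropy = X.entropy := by
  unfold NNSFT.entropy
  congr 1
  funext n
  have hn : ((n : ℕ) : ℝ) ≠ 0 := by positivity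
  rw [langCard_extend X n.pos, Nat.cast_pow, Real.log_pow, pow_succ']
  field_simp

theorem sum_negMulLog_prod {B : Type*} [Fintype B] {p : B → ℝ} (hp : ∑ b, p b = 1) (n : ℕ) :
    ∑ W : Fin n → B, Real.negMulLog (∏ k, p (W k)) = n * ∑ b, Real.negMulLog (p b) := by
  induction n with
  | zero => simp
  | succ n ih =>
    have h1 : ∑ W : Fin n → B, ∏ k, p (W k) = 1 := by rw [← Fintype.sum_pow, hp, one_pow]
    rw [← (Fin.consEquiv fun _ => B).sum_comp, Fintype.sum_prod_type]
    simp only [Fin.consEquiv_apply, Fin.prod_univ_succ, Fin.cons_zero, Fin.cons_succ,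
      Real.negMulLog_mul, Finset.sum_add_distrib, ← Finset.mul_sum, ← Finset.sum_mul, hp, h1, ih]
    push_cast
    ring

theorem sum_measureReal_cyl {d : ℕ} {A ι : Type} [Fintype A] [Fintype ι] [DecidableEq ι]
    (μ : Measure (Site d → A)) [IsProbabilityMeasure μ] (s : ι → Site d) :
    ∑ w : ι → A, (μ {x | ∀ p, x (s p) = w p}).toReal = 1 := by
  have e : ∀ w : ι → A, {x : Site d → A | ∀ p, x (s p) = w p}
      = (fun x p => x (s p)) ⁻¹' {w} := by
    intro w; ext x; simp [funext_iff]
  have h := sum_measureReal_preimage_singleton (μ := μ) (f := fun x p => x (s p))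
    (Finset.univ : Finset (ι → A)) fun w _ => by
      rw [← e]; exact measurableSet_forall_eq s w
  simpa [measureReal_def, e] using h

theorem stackMeasure_cyl {d n : ℕ} {A : Type} (μ : Measure (Site d → A)) [IsProbabilityMeasure μ]
    (w : (Fin (d + 1) → Fin n) → A) :
    stackMeasure μ {x | ∀ p : Fin (d + 1) → Fin n, x (fun i => (p i : ℤ) + 1) = w p}
      = ∏ k : Fin n,
        μ {x | ∀ p : Fin d → Fin n, x (fun i => (p i : ℤ) + 1) = w (Fin.cons k p)} := by
  let e : Fin n ↪ ℤ := ⟨fun k => (k : ℤ) + 1, fun a b h => by simp only at h; omega⟩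
  let c : Fin n → Set (Site d → A) := fun k =>
    {x | ∀ p : Fin d → Fin n, x (fun i => (p i : ℤ) + 1) = w (Fin.cons k p)}
  let t : ℤ → Set (Site d → A) := Function.extend e c fun _ => Set.univ
  have ht : ∀ k, t (e k) = c k := fun k => e.injective.extend_apply _ _ _
  have hpre : stack ⁻¹' {x | ∀ p : Fin (d + 1) → Fin n, x (fun i => (p i : ℤ) + 1) = w p}
      = Set.pi ↑(Finset.univ.map e) t := by
    ext f
    simp only [Set.mem_preimage, Set.mem_ofPred_eq, Set.mem_pi, Finset.mem_coe, Finset.mem_map,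
      Finset.mem_univ, true_and, forall_exists_index, forall_apply_eq_imp_iff, ht]
    constructor
    · intro h k p
      exact h (Fin.cons k p)
    · intro h p
      have := h (p 0) (Fin.tail p)
      rwa [Fin.cons_self_tail] at this
  rw [stackMeasure, Measure.map_apply measurable_stack (measurableSet_forall_eq _ _), hpre,
    Measure.infinitePi_pi, Finset.prod_map]
  · simp only [ht, c]
  · simp only [Finset.mem_map, Finset.mem_univ, true_and, forall_exists_index,
      forall_apply_eq_imp_iff, ht]
    exact fun k => measurableSet_forall_eq _ _

theorem blockEnt_stackMeasure {d : ℕ} {A : Type} [Fintype A] (μ : Measure (Site d → A))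
    [IsProbabilityMeasure μ] (n : ℕ) : blockEnt (stackMeasure μ) n = n * blockEnt μ n := by
  classical
  unfold blockEnt
  rw [← sum_negMulLog_prod (sum_measureReal_cyl μ _) n]
  refine Fintype.sum_equiv
    (((Fin.consEquiv fun _ : Fin (d + 1) => Fin n).symm.arrowCongr (Equiv.refl A)).trans
      (Equiv.curry _ _ _)) _ _ fun w => ?_
  rw [stackMeasure_cyl, ENNReal.toReal_prod]
  rfl

theorem measEnt_stackMeasure {d : ℕ} {A : Type} [Fintype A] (μ : Measure (Site d → A))
    [IsProbabilityMeasure μ] : measEnt (stackMeasure μ) = measEnt μ := by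
  unfold measEnt
  congr 1
  funext n
  have hn : ((n : ℕ) : ℝ) ≠ 0 := by positivity
  rw [blockEnt_stackMeasure, pow_succ']
  field_simp

theorem infinitePi_map_shift {E : Type*} [MeasurableSpace E] (μ : Measure E)
    [IsProbabilityMeasure μ] {g : E → E} (hg : Measurable g) (hμ : μ.map g = μ) (c : ℤ) :
    (Measure.infinitePi fun _ : ℤ => μ).map (fun f k => g (f (k + c)))
      = Measure.infinitePi fun _ : ℤ => μ := by
  refine Measure.eq_infinitePi _ fun s t ht => ?_
  have hm : Measurable fun (f : ℤ → E) k => g (f (k + c)) :=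
    measurable_pi_lambda _ fun k => hg.comp (measurable_pi_apply _)
  have hpre : (fun (f : ℤ → E) k => g (f (k + c))) ⁻¹' Set.pi s t
      = Set.pi ↑(s.map (Equiv.addRight c).toEmbedding) fun k => g ⁻¹' t (k - c) := by
    ext f
    simp only [Set.mem_preimage, Set.mem_pi, Finset.mem_coe, Finset.mem_map,
      Equiv.coe_toEmbedding, Equiv.coe_addRight, forall_exists_index, and_imp,
      forall_apply_eq_imp_iff₂, add_sub_cancel_right]
  rw [Measure.map_apply hm (.pi s.countable_toSet fun i _ => ht i), hpre,
    Measure.infinitePi_pi _ fun i _ => hg (ht _), Finset.prod_map]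
  refine Finset.prod_congr rfl fun k _ => ?_
  rw [← Measure.map_apply hg (ht _), hμ]
  simp

theorem shiftInv_stackMeasure {d : ℕ} {A : Type} (μ : Measure (Site d → A))
    [IsProbabilityMeasure μ] (hμ : shiftInv μ) : shiftInv (stackMeasure μ) := by
  intro t
  have hg := measurable_shiftMap (A := A) (Fin.tail t)
  have hm : Measurable fun (f : ℤ → Site d → A) k => shiftMap (Fin.tail t) (f (k + t 0)) :=
    measurable_pi_lambda _ fun k => hg.comp (measurable_pi_apply _)
  have h : shiftMap t ∘ stack
      = stack ∘ fun (f : ℤ → Site d → A) k => shiftMap (Fin.tail t) (f (k + t 0)) := rfl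
  rw [stackMeasure, Measure.map_map (measurable_shiftMap t) measurable_stack, h,
    ← Measure.map_map measurable_stack hm, infinitePi_map_shift μ hg (hμ _)]

theorem stackMeasure_map_slice {d : ℕ} {A : Type} (μ : Measure (Site d → A))
    [IsProbabilityMeasure μ] :
    (stackMeasure μ).map (fun x v => x (Fin.cons 0 v)) = μ := by
  have hm : Measurable fun (x : Site (d + 1) → A) (v : Site d) => x (Fin.cons 0 v) :=
    measurable_of_evalSite fun v => measurable_evalSite (Fin.cons 0 v)
  rw [stackMeasure, Measure.map_map hm measurable_stack]
  exact Measure.infinitePi_map_eval (fun _ : ℤ => μ) 0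

theorem NNSFT.isMME.stackMeasure {d : ℕ} {A : Type} [Fintype A] {X : NNSFT d A}
    {μ : Measure (Site d → A)} (h : X.isMME μ) : X.extend.isMME (stackMeasure μ) := by
  obtain ⟨hprob, hinv, hpts, hent⟩ := h
  have hprob' : IsProbabilityMeasure (_root_.stackMeasure μ) :=
    Measure.isProbabilityMeasure_map measurable_stack.aemeasurable
  refine ⟨hprob', shiftInv_stackMeasure μ hinv, ?_, ?_⟩
  · rw [← mem_ae_iff_prob_eq_one X.extend.measurableSet_pts, _root_.stackMeasure,
      mem_ae_map_iff measurable_stack.aemeasurable X.extend.measurableSet_pts]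
    have hae : ∀ᵐ x ∂μ, x ∈ X.pts := (mem_ae_iff_prob_eq_one X.measurableSet_pts).2 hpts
    have : ∀ᵐ f ∂Measure.infinitePi fun _ : ℤ => μ, ∀ k, f k ∈ X.pts := by
      rw [ae_all_iff]
      exact fun k => (measurePreserving_eval_infinitePi (fun _ : ℤ => μ) k).quasiMeasurePreserving.ae
        hae
    filter_upwards [this] with f hf
    exact (stack_mem_pts_extend X).2 hf
  · rw [measEnt_stackMeasure, hent, entropy_extend]

theorem bddBelow_entropy {d : ℕ} {A : Type} (X : NNSFT d A) :
    BddBelow (Set.range fun n : ℕ+ =>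
      Real.log (X.langCard (cube d (n : ℕ))) / ((n : ℕ) : ℝ) ^ d) :=
  ⟨0, by rintro _ ⟨n, rfl⟩; exact div_nonneg (Real.log_natCast_nonneg _) (by positivity)⟩

theorem entropy_le_log_card {d : ℕ} {A : Type} [Fintype A] (X : NNSFT d A) :
    X.entropy ≤ Real.log (Fintype.card A) := by
  refine (ciInf_le (bddBelow_entropy X) 1).trans ?_
  have hsub : Subsingleton (cube d ((1 : ℕ+) : ℕ)) := by
    refine ⟨fun ⟨u, hu⟩ ⟨v, hv⟩ => Subtype.ext (funext fun i => ?_)⟩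
    have hu := hu i
    have hv := hv i
    simp only [PNat.one_coe, Nat.cast_one] at hu hv
    simp only
    omega
  have hcard : X.langCard (cube d ((1 : ℕ+) : ℕ)) ≤ Fintype.card A := by
    have : Set.InjOn (fun w : cube d ((1 : ℕ+) : ℕ) → A =>
        w ⟨fun _ => 1, fun _ => by simp⟩) Set.univ := by
      intro w _ w' _ h
      funext v
      rw [Subsingleton.elim v ⟨fun _ => 1, fun _ => by simp⟩]
      exact h
    rw [← Nat.card_eq_fintype_card, ← Set.ncard_univ]
    exact Set.ncard_le_ncard_of_injOn _ (fun _ _ => trivial) (this.mono (Set.subset_univ _))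
  simp only [PNat.one_coe, Nat.cast_one, one_pow, div_one] at hcard ⊢
  rcases Nat.eq_zero_or_pos (X.langCard (cube d 1)) with h | h
  · rw [h, Nat.cast_zero, Real.log_zero]
    exact Real.log_natCast_nonneg _
  · exact Real.log_le_log (by exact_mod_cast h) (by exact_mod_cast hcard)

/-- The SFT over `Bool` whose points are the constant configurations. -/
def constSFT (d : ℕ) : NNSFT d Bool := ⟨fun _ => Eq⟩

theorem eq_const_of_mem_pts {d : ℕ} {x : Site d → Bool} (hx : x ∈ (constSFT d).pts) :
    x = fun _ => x 0 := by
  let H : AddSubgroup (Site d) :=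
    { carrier := {t | ∀ v, x (v + t) = x v}
      zero_mem' := by simp
      add_mem' := by
        intro a b ha hb v
        rw [← add_assoc, hb, ha]
      neg_mem' := by
        intro a ha v
        rw [← ha (v + -a), neg_add_cancel_right] }
  have he : ∀ i, unitVec d i ∈ H := fun i v => (hx i v).symm
  funext v
  have hv : v = ∑ i, v i • unitVec d i := by
    ext j
    simp [unitVec]
  have : v ∈ H := by
    rw [hv]
    exact H.sum_mem fun i _ => H.zsmul_mem (he i) _
  simpa using this 0

theorem entropy_constSFT {d : ℕ} (hd : 1 ≤ d) : (constSFT d).entropy = 0 := by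
  refine le_antisymm ?_ (le_ciInf fun n =>
    div_nonneg (Real.log_natCast_nonneg _) (by positivity))
  have hcard : ∀ S, (constSFT d).langCard S ≤ 2 := by
    intro S
    have hsub : (constSFT d).langSet S ⊆ Set.range fun (b : Bool) (_ : S) => b := by
      rintro _ ⟨x, hx, rfl⟩
      rw [eq_const_of_mem_pts hx]
      exact ⟨x 0, rfl⟩
    refine (Set.ncard_le_ncard hsub (Set.finite_range _)).trans ?_
    rw [← Set.image_univ]
    exact (Set.ncard_image_le Set.finite_univ).trans (by simp)
  have hlim : Filter.Tendsto (fun n : ℕ => Real.log 2 / ((n + 1 : ℕ) : ℝ) ^ d)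
      Filter.atTop (nhds 0) :=
    (tendsto_const_div_pow (Real.log 2) d (by omega)).comp (Filter.tendsto_add_atTop_nat 1)
  refine ge_of_tendsto' hlim fun n => ?_
  refine (ciInf_le (bddBelow_entropy _) n.succPNat).trans ?_
  simp only [Nat.succPNat_coe, Nat.succ_eq_add_one]
  refine div_le_div_of_nonneg_right ?_ (by positivity)
  rcases Nat.eq_zero_or_pos ((constSFT d).langCard (cube d (n + 1))) with h | h
  · rw [h, Nat.cast_zero, Real.log_zero]
    positivity
  · exact Real.log_le_log (by exact_mod_cast h) (by exact_mod_cast hcard _)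

theorem isMME_dirac_const {d : ℕ} (hd : 1 ≤ d) (b : Bool) :
    (constSFT d).isMME (Measure.dirac fun _ => b) := by
  refine ⟨inferInstance, fun t => ?_, ?_, ?_⟩
  · rw [Measure.map_dirac' (measurable_shiftMap t)]
    rfl
  · rw [Measure.dirac_apply' _ (constSFT d).measurableSet_pts]
    have h : (fun _ => b) ∈ (constSFT d).pts := fun _ _ => rfl
    simp [h]
  · rw [entropy_constSFT hd]
    have : ∀ n, blockEnt (Measure.dirac fun _ : Site d => b) n = 0 := by
      intro n
      refine Finset.sum_eq_zero fun w _ => ?_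
      rw [Measure.dirac_apply' _ (measurableSet_forall_eq _ _), Set.indicator_apply]
      split_ifs <;> simp
    simp [measEnt, this]

theorem dirac_const_ne (d : ℕ) :
    (Measure.dirac fun _ : Site d => true) ≠ Measure.dirac fun _ : Site d => false := by
  intro h
  have := congrArg (fun μ => μ {x : Site d → Bool | x 0 = true}) h
  simp [Measure.dirac_apply' _ (measurableSet_evalSite_eq (0 : Site d) true)] at this

theorem alphaD_antitone (d : ℕ) (hd : 1 ≤ d) : alphaD (d + 1) ≤ alphaD d := by
  refine csInf_le_csInf ⟨0, ?_⟩ ?_ ?_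
  · rintro α ⟨A, inst, X, μ, ν, -, -, -, h⟩
    linarith [entropy_le_log_card X]
  · exact ⟨Real.log (Fintype.card Bool) - (constSFT d).entropy, Bool, inferInstance, constSFT d,
      _, _, isMME_dirac_const hd true, isMME_dirac_const hd false, dirac_const_ne d, by simp⟩
  · rintro α ⟨A, inst, X, μ, ν, hμ, hν, hne, h⟩
    refine ⟨A, inst, X.extend, _, _, hμ.stackMeasure, hν.stackMeasure, fun heq => hne ?_, ?_⟩
    · have := hμ.1
      have := hν.1
      rw [← stackMeasure_map_slice μ, heq, stackMeasure_map_slice ν]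
    · rwa [entropy_extend]
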